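/- (Theorem 1, safety with a static governor.) Let Ā be a real n_s × n_s matrix, let Q be a symmetric positive definite n×n matrix, C = Q^{1/2} P' where P' = [I 0] is the n × n_s projection onto the first n coordinates, and let g₀ ∈ ℝⁿ. Suppose U is symmetric positive definite and δ ≥ 0 satisfy Āᵀ U + U Ā ⪯ 0, s̃₀ᵀ U s̃₀ ≤ 1, and [[U, Cᵀ], [C, δI]] ⪰ 0, where s̃₀ is the initial shifted state. Let s̃ : ℝ → ℝ^{n_s} solve s̃'(t) = Ā s̃(t) with s̃(t₀) = s̃₀, and let x(t) = P' s̃(t) + g₀ be the robot position. If the obstacle set O ⊆ ℝⁿ satisfies the strict safety condition (o − g₀)ᵀ Q (o − g₀) > δ for every o ∈ O, then the robot trajectory is collision free: x(t) ∉ O for all t ≥ t₀. -/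

import Mathlib

open Matrix
open scoped MatrixOrder

/-- Theorem 1, safety with a static governor: with
`C = Q^{1/2} P'` for the projection `P' = [I 0]` onto the robot position
coordinates, if `U ≻ 0` and `δ ≥ 0` satisfy the SDP constraints
`Āᵀ U + U Ā ⪯ 0`, `s̃₀ᵀ U s̃₀ ≤ 1`, `[[U, Cᵀ], [C, δI]] ⪰ 0`, and the obstacle
set `O` satisfies the strict safety condition `δ < (o − g₀)ᵀ Q (o − g₀)` for
all `o ∈ O`, then the robot trajectory `x(t) = P' s̃(t) + g₀` of the static
governor system is collision free: `x(t) ∉ O` for all `t ≥ t₀`. -/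
theorem static_governor_safety {n m : ℕ}
    (Abar U : Matrix (Fin n ⊕ Fin m) (Fin n ⊕ Fin m) ℝ)
    (Q : Matrix (Fin n) (Fin n) ℝ) (hQ : Q.PosDef)
    (g₀ : Fin n → ℝ) (s₀ : Fin n ⊕ Fin m → ℝ) (δ : ℝ) (hδ : 0 ≤ δ)
    (hUsymm : Uᵀ = U)
    (hUpd : ∀ q : Fin n ⊕ Fin m → ℝ, q ≠ 0 → 0 < q ⬝ᵥ U *ᵥ q)
    (hLyap : ∀ q : Fin n ⊕ Fin m → ℝ, q ⬝ᵥ (Abarᵀ * U + U * Abar) *ᵥ q ≤ 0)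
    (hs₀ : s₀ ⬝ᵥ U *ᵥ s₀ ≤ 1)
    (hblock :
      (Matrix.fromBlocks U
          (CFC.sqrt Q *
            Matrix.fromCols (1 : Matrix (Fin n) (Fin n) ℝ)
              (0 : Matrix (Fin n) (Fin m) ℝ))ᵀ
          (CFC.sqrt Q *
            Matrix.fromCols (1 : Matrix (Fin n) (Fin n) ℝ)
              (0 : Matrix (Fin n) (Fin m) ℝ))
          (δ • (1 : Matrix (Fin n) (Fin n) ℝ))).PosSemidef)
    (t₀ : ℝ) (stilde : ℝ → (Fin n ⊕ Fin m → ℝ))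
    (hstilde : ∀ t : ℝ, HasDerivAt stilde (Abar *ᵥ stilde t) t)
    (hinit : stilde t₀ = s₀)
    (O : Set (Fin n → ℝ))
    (hsafe : ∀ o ∈ O, δ < (o - g₀) ⬝ᵥ Q *ᵥ (o - g₀)) :
    ∀ t : ℝ, t₀ ≤ t →
      (Matrix.fromCols (1 : Matrix (Fin n) (Fin n) ℝ)
          (0 : Matrix (Fin n) (Fin m) ℝ)) *ᵥ stilde t + g₀ ∉ O := by
  intro t ht hmem
  set P : Matrix (Fin n) (Fin n ⊕ Fin m) ℝ := Matrix.fromCols 1 0 with hP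
  set R := CFC.sqrt Q with hR
  have hRR : R * R = Q := CFC.sqrt_mul_sqrt_self Q hQ.posSemidef.nonneg
  have hRt : Rᵀ = R := by
    have h := (Matrix.nonneg_iff_posSemidef.1 (CFC.sqrt_nonneg Q)).isHermitian
    have h2 := h.eq
    rwa [Matrix.conjTranspose_eq_transpose_of_trivial] at h2
  have hd : ∀ r, HasDerivAt (fun r => stilde r ⬝ᵥ U *ᵥ stilde r)
      (stilde r ⬝ᵥ (Abarᵀ * U + U * Abar) *ᵥ stilde r) r := by
    intro r
    have h1 := hasDerivAt_pi.1 (hstilde r)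
    have h2 : ∀ i, HasDerivAt (fun r => (U *ᵥ stilde r) i) ((U *ᵥ (Abar *ᵥ stilde r)) i) r := by
      intro i
      simp only [Matrix.mulVec, dotProduct]
      exact HasDerivAt.fun_sum fun j _ => (h1 j).const_mul (U i j)
    have h3 : HasDerivAt (fun r => ∑ i, stilde r i * (U *ᵥ stilde r) i)
      (∑ i, ((Abar *ᵥ stilde r) i * (U *ᵥ stilde r) i
        + stilde r i * (U *ᵥ (Abar *ᵥ stilde r)) i)) r :=
      HasDerivAt.fun_sum fun i _ => (h1 i).mul (h2 i)
    refine h3.congr_deriv ?_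
    rw [Finset.sum_add_distrib]
    change (Abar *ᵥ stilde r) ⬝ᵥ (U *ᵥ stilde r) + stilde r ⬝ᵥ (U *ᵥ (Abar *ᵥ stilde r)) = _
    rw [Matrix.add_mulVec, dotProduct_add, ← Matrix.mulVec_mulVec, ← Matrix.mulVec_mulVec,
      Matrix.dotProduct_mulVec (stilde r) Abarᵀ, Matrix.vecMul_transpose]
  have hanti : Antitone (fun r => stilde r ⬝ᵥ U *ᵥ stilde r) :=
    antitone_of_hasDerivAt_nonpos hd fun r => hLyap _
  have hV : stilde t ⬝ᵥ U *ᵥ stilde t ≤ 1 := by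
    have h := hanti ht
    simp only [hinit] at h
    exact h.trans hs₀
  have hs := hsafe _ hmem
  rw [add_sub_cancel_right] at hs
  set s := stilde t with hsdef
  set y := (R * P) *ᵥ s with hy
  have hN : (P *ᵥ s) ⬝ᵥ Q *ᵥ (P *ᵥ s) = y ⬝ᵥ y := by
    rw [hy, ← Matrix.mulVec_mulVec, ← hRR, ← Matrix.mulVec_mulVec,
      Matrix.dotProduct_mulVec (P *ᵥ s) R, ← Matrix.mulVec_transpose, hRt]
  rw [hN] at hs
  have hb := hblock.dotProduct_mulVec_nonneg (Sum.elim ((y ⬝ᵥ y) • s) (-y))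
  have hc : s ⬝ᵥ (R * P)ᵀ *ᵥ y = y ⬝ᵥ y := by
    rw [Matrix.dotProduct_mulVec, Matrix.vecMul_transpose]
  have hyy : (R * P) *ᵥ s = y := rfl
  rw [star_trivial, Matrix.fromBlocks_mulVec, sumElim_dotProduct_sumElim] at hb
  simp only [Sum.elim_comp_inl, Sum.elim_comp_inr, Matrix.mulVec_smul, Matrix.mulVec_neg,
    dotProduct_add, smul_dotProduct, dotProduct_smul, neg_dotProduct, dotProduct_neg, hc, hyy,
    Matrix.smul_mulVec, Matrix.one_mulVec, smul_eq_mul] at hb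
  generalize y ⬝ᵥ y = N at *
  generalize s ⬝ᵥ U *ᵥ s = V at *
  have hNpos : 0 < N := lt_of_le_of_lt hδ hs
  nlinarith [mul_pos hNpos (sub_pos.2 hs), mul_nonneg (sq_nonneg N) (sub_nonneg.2 hV)]
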